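/- If ℓ is a prime with ℓ ≡ 1, 5, 7 or 11 (mod 24), then for all positive integers n not divisible by ℓ, p̄_o(3ℓ²n) ≡ 0 (mod 3). -/

import Mathlib

/-- Number of overpartitions of `n` into odd parts: pairs consisting of a
partition of some `m ≤ n` into distinct odd parts (the overlined parts)
and a partition of `n - m` into odd parts. -/
def pbarOdd (n : ℕ) : ℕ :=
  ∑ m ∈ Finset.range (n + 1),
    (Nat.Partition.oddDistincts m).card * (Nat.Partition.odds (n - m)).card

open PowerSeries Filter
open scoped PowerSeries.WithPiTopology Topology

/-- The generating function of a weight `w` twisted by coefficients `s`, that is, the series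
`∑ i, s i * X ^ w i`. -/
noncomputable def thetaSeries {ι R : Type*} [CommRing R] (w : ι → ℕ) (s : ι → R) : R⟦X⟧ :=
  PowerSeries.mk fun n ↦ ∑ᶠ i ∈ w ⁻¹' {n}, s i

section ThetaSeries

variable {ι κ R : Type*} [CommRing R] {w : ι → ℕ} {w' : κ → ℕ}

lemma finite_preimage_add (hw : ∀ n, (w ⁻¹' {n}).Finite) (hw' : ∀ n, (w' ⁻¹' {n}).Finite)
    (n : ℕ) : ((fun p : ι × κ ↦ w p.1 + w' p.2) ⁻¹' {n}).Finite := by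
  refine ((Finset.HasAntidiagonal.antidiagonal n).finite_toSet.biUnion
    fun p _ ↦ (hw p.1).prod (hw' p.2)).subset fun p hp ↦ ?_
  simp only [Set.mem_preimage, Set.mem_singleton_iff] at hp
  simp only [Set.mem_iUnion]
  exact ⟨(w p.1, w' p.2), by simpa using hp, by simp⟩

lemma thetaSeries_mul (hw : ∀ n, (w ⁻¹' {n}).Finite) (hw' : ∀ n, (w' ⁻¹' {n}).Finite)
    (s : ι → R) (s' : κ → R) :
    thetaSeries w s * thetaSeries w' s' =
      thetaSeries (fun p : ι × κ ↦ w p.1 + w' p.2) fun p ↦ s p.1 * s' p.2 := by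
  ext n
  have h : (fun p : ι × κ ↦ w p.1 + w' p.2) ⁻¹' {n} =
      ⋃ p ∈ (Finset.HasAntidiagonal.antidiagonal n : Set (ℕ × ℕ)), (w ⁻¹' {p.1}) ×ˢ (w' ⁻¹' {p.2}) := by
    ext p
    simp
  rw [PowerSeries.coeff_mul, thetaSeries, thetaSeries, thetaSeries, coeff_mk, h,
    finsum_mem_biUnion _ (Finset.finite_toSet _) fun p _ ↦ (hw p.1).prod (hw' p.2),
    finsum_mem_coe_finset]
  · refine Finset.sum_congr rfl fun p _ ↦ ?_
    rw [coeff_mk, coeff_mk, finsum_mem_eq_finite_toFinset_sum _ (hw _),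
      finsum_mem_eq_finite_toFinset_sum _ (hw' _),
      finsum_mem_eq_finite_toFinset_sum _ ((hw _).prod (hw' _)), Finset.sum_mul_sum,
      ← Finset.sum_product', Set.Finite.toFinset_prod]
  · intro p _ q _ hpq
    refine Set.disjoint_left.mpr fun x hx hx' ↦ hpq ?_
    simp only [Set.mem_prod, Set.mem_preimage, Set.mem_singleton_iff] at hx hx'
    ext
    · exact hx.1.symm.trans hx'.1
    · exact hx.2.symm.trans hx'.2

end ThetaSeries

section Gauss

variable {R : Type*} [CommRing R]

/-- The terms of Shanks' finite form of Gauss' product formula for `∑ j, (-1) ^ j * q ^ (j ^ 2)`. -/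
def shanksTerm (q : R) (n s : ℕ) : R :=
  (-1) ^ s * q ^ (s * (n + 1)) * (∏ i ∈ Finset.Ico s n, (1 - q ^ (i + 1))) *
    ∏ i ∈ Finset.range s, (1 + q ^ i)

lemma shanksTerm_succ_left (q : R) {n s : ℕ} (h : s ≤ n) :
    shanksTerm q (n + 1) s = q ^ s * (1 - q ^ (n + 1)) * shanksTerm q n s := by
  simp only [shanksTerm, Finset.prod_Ico_succ_top h]
  ring

lemma shanksTerm_succ_right (q : R) {n s : ℕ} (h : s < n) :
    (1 - q ^ (s + 1)) * shanksTerm q n (s + 1) =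
      -(q ^ (n + 1) * (1 + q ^ s) * shanksTerm q n s) := by
  simp only [shanksTerm, Finset.prod_range_succ, Finset.prod_eq_prod_Ico_succ_bot h]
  ring

lemma sum_shanksTerm_telescope (q : R) {n m : ℕ} (h : m ≤ n) :
    ∑ s ∈ Finset.range (m + 1), (1 - q ^ s + q ^ (n + 1) * (1 + q ^ s)) * shanksTerm q n s =
      q ^ (n + 1) * (1 + q ^ m) * shanksTerm q n m := by
  induction m with
  | zero => simp
  | succ m ih =>
    rw [Finset.sum_range_succ, ih (by omega)]
    linear_combination shanksTerm_succ_right q (show m < n by omega)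

lemma sum_Icc_neg_succ (f : ℤ → R) (n : ℕ) :
    ∑ j ∈ Finset.Icc (-((n + 1 : ℕ) : ℤ)) (n + 1 : ℕ), f j =
      ∑ j ∈ Finset.Icc (-(n : ℤ)) n, f j + f (n + 1) + f (-(n + 1)) := by
  have h : Finset.Icc (-((n + 1 : ℕ) : ℤ)) (n + 1 : ℕ) =
      insert (-(n + 1 : ℤ)) (insert (n + 1 : ℤ) (Finset.Icc (-(n : ℤ)) n)) := by
    ext j
    simp only [Finset.mem_Icc, Finset.mem_insert]
    omega
  rw [h, Finset.sum_insert, Finset.sum_insert]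
  · ring
  · simp
  · simp only [Finset.mem_Icc, Finset.mem_insert]
    omega

lemma sum_mul_prod_eq_sum_shanksTerm (q : R) (n : ℕ) :
    (∑ j ∈ Finset.Icc (-(n : ℤ)) n, (-1) ^ j.natAbs * q ^ j.natAbs ^ 2) *
      ∏ i ∈ Finset.range n, (1 + q ^ (i + 1)) =
    ∑ s ∈ Finset.range (n + 1), shanksTerm q n s := by
  induction n with
  | zero => simp [shanksTerm]
  | succ n ih =>
    have key := sum_shanksTerm_telescope q (le_refl n)
    have hstep : ∑ s ∈ Finset.range (n + 1), shanksTerm q (n + 1) s =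
        (1 + q ^ (n + 1)) * ∑ s ∈ Finset.range (n + 1), shanksTerm q n s -
        ∑ s ∈ Finset.range (n + 1),
          (1 - q ^ s + q ^ (n + 1) * (1 + q ^ s)) * shanksTerm q n s := by
      rw [Finset.mul_sum, ← Finset.sum_sub_distrib]
      refine Finset.sum_congr rfl fun s hs ↦ ?_
      rw [shanksTerm_succ_left q (Nat.lt_succ_iff.mp (Finset.mem_range.mp hs))]
      ring
    have hprod : ∏ i ∈ Finset.range (n + 1), (1 + q ^ i) =
        2 * ∏ i ∈ Finset.range n, (1 + q ^ (i + 1)) := by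
      rw [Finset.prod_range_succ']
      ring
    rw [Finset.sum_range_succ, hstep, key, ← ih, sum_Icc_neg_succ, Finset.prod_range_succ]
    have h1 : (-((n : ℤ) + 1)).natAbs = n + 1 := by omega
    have h2 : ((n : ℤ) + 1).natAbs = n + 1 := by omega
    have h3 : shanksTerm q n n = (-1) ^ n * q ^ (n * (n + 1)) * ∏ i ∈ Finset.range n, (1 + q ^ i) := by
      simp [shanksTerm]
    have h4 : shanksTerm q (n + 1) (n + 1) = (-1) ^ (n + 1) * q ^ ((n + 1) * (n + 2)) *
        ∏ i ∈ Finset.range (n + 1), (1 + q ^ i) := by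
      simp [shanksTerm]
    have h5 : (1 + q ^ n) * shanksTerm q n n = (-1) ^ n * q ^ (n * (n + 1)) *
        (2 * ∏ i ∈ Finset.range n, (1 + q ^ (i + 1))) := by
      rw [h3, ← hprod, Finset.prod_range_succ]
      ring
    rw [h1, h2, h4, hprod, mul_assoc (q ^ (n + 1)), h5]
    ring

end Gauss

section GaussLimit

variable {R : Type*} [CommRing R] [TopologicalSpace R]

lemma finite_preimage_mul_natAbs_sq {k : ℕ} (hk : k ≠ 0) (n : ℕ) :
    ((fun j : ℤ ↦ k * j.natAbs ^ 2) ⁻¹' {n}).Finite := by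
  refine (Set.finite_Icc (-(n : ℤ)) n).subset fun j hj ↦ ?_
  have hj : k * j.natAbs ^ 2 = n := hj
  have h : j.natAbs ≤ n := by
    rw [← hj]
    exact (Nat.le_self_pow two_ne_zero _).trans (Nat.le_mul_of_pos_left _ (Nat.pos_of_ne_zero hk))
  simp only [Set.mem_Icc]
  omega

lemma tendsto_sum_Icc_thetaSeries {k : ℕ} (hk : k ≠ 0) (s : ℤ → R) :
    Tendsto (fun n : ℕ ↦ ∑ j ∈ Finset.Icc (-(n : ℤ)) n, C (s j) * X ^ (k * j.natAbs ^ 2)) atTop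
      (𝓝 (thetaSeries (fun j : ℤ ↦ k * j.natAbs ^ 2) s)) := by
  rw [WithPiTopology.tendsto_iff_coeff_tendsto]
  refine fun d ↦ tendsto_atTop_of_eventually_const (i₀ := d) fun n hn ↦ ?_
  rw [thetaSeries, coeff_mk, finsum_mem_eq_finite_toFinset_sum _
    (finite_preimage_mul_natAbs_sq hk d), map_sum]
  simp only [coeff_C_mul, coeff_X_pow, mul_ite, mul_one, mul_zero]
  rw [← Finset.sum_filter]
  refine Finset.sum_congr ?_ fun _ _ ↦ rfl
  ext j
  simp only [Finset.mem_filter, Finset.mem_Icc, Set.Finite.mem_toFinset, Set.mem_preimage,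
    Set.mem_singleton_iff, eq_comm (a := d), and_iff_right_iff_imp]
  intro hj
  have h : j.natAbs ≤ d := by
    rw [← hj]
    exact (Nat.le_self_pow two_ne_zero _).trans (Nat.le_mul_of_pos_left _ (Nat.pos_of_ne_zero hk))
  omega

lemma mul_eq_of_tendsto_shanks [IsTopologicalRing R] [T2Space R] {q θ a b : R⟦X⟧}
    (hq : constantCoeff q = 0) (ha : HasProd (fun i ↦ 1 + q ^ (i + 1)) a)
    (hb : HasProd (fun i ↦ 1 - q ^ (i + 1)) b)
    (hθ : Tendsto (fun n : ℕ ↦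
      ∑ j ∈ Finset.Icc (-(n : ℤ)) n, (-1) ^ j.natAbs * q ^ j.natAbs ^ 2) atTop (𝓝 θ)) :
    θ * a = b := by
  have h0 : Tendsto (fun n : ℕ ↦ ∑ s ∈ Finset.range n, shanksTerm q n (s + 1)) atTop (𝓝 0) := by
    rw [WithPiTopology.tendsto_iff_coeff_tendsto]
    refine fun d ↦ tendsto_atTop_of_eventually_const (i₀ := d) fun n hn ↦ ?_
    rw [map_sum, map_zero]
    refine Finset.sum_eq_zero fun s _ ↦ ?_
    have hdvd : X ^ ((s + 1) * (n + 1)) ∣ shanksTerm q n (s + 1) :=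
      (((pow_dvd_pow_of_dvd (X_dvd_iff.mpr hq) _).mul_left _).mul_right _).mul_right _
    exact X_pow_dvd_iff.mp hdvd d (by nlinarith)
  have h1 := (hθ.mul ha.tendsto_prod_nat)
  have h2 := h0.add hb.tendsto_prod_nat
  rw [zero_add] at h2
  refine tendsto_nhds_unique h1 (h2.congr fun n ↦ ?_)
  rw [sum_mul_prod_eq_sum_shanksTerm, Finset.sum_range_succ']
  simp [shanksTerm]

variable (R)

lemma multipliable_one_add_mul_X_pow (c : ℕ → R) {f : ℕ → ℕ} (hf : ∀ i, i ≤ f i) :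
    Multipliable fun i ↦ 1 + C (c i) * (X : R⟦X⟧) ^ f i := by
  nontriviality R using Subsingleton.eq_zero (α := R⟦X⟧)
  refine WithPiTopology.multipliable_one_add_of_tendsto_order_atTop_nhds_top _ ?_
  refine ENat.tendsto_nhds_top_iff_natCast_lt.mpr fun n ↦ eventually_atTop.mpr ⟨n + 1, ?_⟩
  intro m hm
  refine lt_of_lt_of_le ?_ (nat_le_order _ (m : ℕ) fun i hi ↦ ?_)
  · exact_mod_cast hm
  · rw [coeff_C_mul, coeff_X_pow, if_neg (by have := hf m; omega), mul_zero]

lemma hasProd_card_oddDistincts [IsTopologicalRing R] [T2Space R] :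
    HasProd (fun i : ℕ ↦ 1 + (X : R⟦X⟧) ^ (2 * i + 1))
      (PowerSeries.mk fun n ↦ ((Nat.Partition.oddDistincts n).card : R)) := by
  have h := Nat.Partition.hasProd_genFun (fun i c ↦ if ¬ Even i ∧ c < 2 then (1 : R) else 0)
  have hinj : Function.Injective fun i : ℕ ↦ 2 * i := fun a b h ↦ by simpa using h
  rw [← hinj.hasProd_iff] at h
  · convert! h using 1
    · ext1 i
      rw [Function.comp_apply, tsum_eq_single 0]
      · simp
      · intro j hj
        rw [if_neg (by omega), zero_smul]
    · ext n
      simp only [coeff_mk, Nat.Partition.coeff_genFun, Finsupp.prod, Finset.prod_boole,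
        Nat.Partition.oddDistincts, Nat.Partition.odds, Nat.Partition.restricted,
        Nat.Partition.distincts, ← Finset.filter_and, Finset.card_filter, Nat.cast_sum]
      refine Finset.sum_congr rfl fun p _ ↦ ?_
      rw [Nat.cast_ite, Nat.cast_one, Nat.cast_zero]
      refine if_congr ?_ rfl rfl
      simp only [Multiset.toFinsupp_support, Multiset.mem_toFinset, Multiset.toFinsupp_apply,
        Multiset.nodup_iff_count_le_one, forall_and]
      refine and_congr Iff.rfl ⟨fun H i _ ↦ Nat.lt_succ_iff.mpr (H i), fun H i ↦ ?_⟩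
      by_cases hi : i ∈ p.parts
      · exact Nat.lt_succ_iff.mp (H i hi)
      · simp [Multiset.count_eq_zero_of_notMem hi]
  · intro i hi
    have : Even (i + 1) := by
      by_contra hodd
      rw [Nat.not_even_iff_odd] at hodd
      obtain ⟨m, hm⟩ := hodd
      exact hi ⟨m, by simp only; omega⟩
    simp [this]

lemma hasProd_card_odds [IsTopologicalRing R] [T2Space R] :
    HasProd (fun i : ℕ ↦ ∑' j : ℕ, (X : R⟦X⟧) ^ ((2 * i + 1) * j))
      (PowerSeries.mk fun n ↦ ((Nat.Partition.odds n).card : R)) := by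
  have h := Nat.Partition.hasProd_powerSeriesMk_card_restricted R (fun i ↦ ¬ Even i)
  have hinj : Function.Injective fun i : ℕ ↦ 2 * i := fun a b h ↦ by simpa using h
  rw [← hinj.hasProd_iff] at h
  · convert! h using 1
    ext1 i
    simp
  · intro i hi
    rw [if_neg]
    rw [not_not]
    by_contra hodd
    rw [Nat.not_even_iff_odd] at hodd
    obtain ⟨m, hm⟩ := hodd
    exact hi ⟨m, by simp only; omega⟩

end GaussLimit

section GeneratingFunction

variable (R : Type*) [CommRing R]

/-- Ramanujan's theta function `φ(X) = ∑ j, X ^ (j ^ 2)`. -/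
noncomputable def phiPos : R⟦X⟧ := thetaSeries (fun j : ℤ ↦ 1 * j.natAbs ^ 2) fun _ ↦ 1

/-- The series `φ(-X ^ k) = ∑ j, (-1) ^ j * X ^ (k * j ^ 2)`. -/
noncomputable def phiNeg (k : ℕ) : R⟦X⟧ :=
  thetaSeries (fun j : ℤ ↦ k * j.natAbs ^ 2) fun j ↦ (-1) ^ j.natAbs

lemma mk_pbarOdd : (PowerSeries.mk fun n ↦ (pbarOdd n : R)) =
    (PowerSeries.mk fun n ↦ ((Nat.Partition.oddDistincts n).card : R)) *
      PowerSeries.mk fun n ↦ ((Nat.Partition.odds n).card : R) := by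
  ext n
  rw [PowerSeries.coeff_mul, Finset.Nat.sum_antidiagonal_eq_sum_range_succ_mk]
  simp [pbarOdd]

/-- The generating function of `pbarOdd` is `φ(X) / φ(-X ^ 2)`. -/
lemma mk_pbarOdd_mul_phiNeg_two [IsDomain R] :
    (PowerSeries.mk fun n ↦ (pbarOdd n : R)) * phiNeg R 2 = phiPos R := by
  let _ : TopologicalSpace R := ⊥
  have _ : DiscreteTopology R := ⟨rfl⟩
  have hadd2 := (multipliable_one_add_mul_X_pow R 1 (f := fun i ↦ 2 * (i + 1)) (by omega)).hasProd
  have hsub2 := (multipliable_one_add_mul_X_pow R (-1) (f := fun i ↦ 2 * (i + 1)) (by omega)).hasProd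
  have hsub1 := (multipliable_one_add_mul_X_pow R (-1) (f := fun i ↦ 2 * i + 1) (by omega)).hasProd
  have hadd1 := hasProd_card_oddDistincts R
  have hodd := hasProd_card_odds R
  set A₂ := ∏' i, (1 + C ((1 : ℕ → R) i) * (X : R⟦X⟧) ^ (2 * (i + 1)))
  set E₂ := ∏' i, (1 + C ((-1 : ℕ → R) i) * (X : R⟦X⟧) ^ (2 * (i + 1)))
  set D' := ∏' i, (1 + C ((-1 : ℕ → R) i) * (X : R⟦X⟧) ^ (2 * i + 1))
  rw [mk_pbarOdd]
  set D : R⟦X⟧ := PowerSeries.mk fun n ↦ ((Nat.Partition.oddDistincts n).card : R)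
  set O : R⟦X⟧ := PowerSeries.mk fun n ↦ ((Nat.Partition.odds n).card : R)
  simp only [Pi.one_apply, Pi.neg_apply, map_neg, map_one, neg_mul, one_mul, ← sub_eq_add_neg]
    at hadd2 hsub2 hsub1
  have hOD : O * D' = 1 := by
    refine (hodd.mul hsub1).unique ?_
    convert! hasProd_one using 2 with i
    simp_rw [pow_mul]
    exact WithPiTopology.tsum_pow_mul_one_sub_of_constantCoeff_eq_zero (by simp)
  have hA₂ : A₂ ≠ 0 := by
    have h := hadd2.map (constantCoeff (R := R)) (WithPiTopology.continuous_constantCoeff R)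
    have h1 : HasProd (fun _ : ℕ ↦ (1 : R)) (constantCoeff A₂) := by
      convert! h using 2 with i
      simp
    intro h0
    rw [h0, map_zero] at h1
    exact zero_ne_one (h1.unique hasProd_one)
  have h2 : phiNeg R 2 * A₂ = E₂ := by
    refine mul_eq_of_tendsto_shanks (q := X ^ 2) (by simp) ?_ ?_ ?_
    · simpa only [← pow_mul] using hadd2
    · simpa only [← pow_mul] using hsub2
    · refine (tendsto_sum_Icc_thetaSeries two_ne_zero _).congr fun n ↦ ?_
      simp [pow_mul]
  have h1 : phiPos R * (D' * A₂) = D * E₂ := by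
    refine mul_eq_of_tendsto_shanks (q := -X) (by simp) ?_ ?_ ?_
    · refine HasProd.even_mul_odd ?_ ?_
      · convert! hsub1 using 2 with i
        rw [Odd.neg_pow (by simp), sub_eq_add_neg]
      · convert! hadd2 using 2 with i
        rw [Even.neg_pow ⟨i + 1, by ring⟩]
        ring
    · refine HasProd.even_mul_odd ?_ ?_
      · convert! hadd1 using 2 with i
        rw [Odd.neg_pow (by simp), sub_neg_eq_add]
      · convert! hsub2 using 2 with i
        rw [Even.neg_pow ⟨i + 1, by ring⟩]
        ring
    · refine (tendsto_sum_Icc_thetaSeries one_ne_zero _).congr fun n ↦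
        Finset.sum_congr rfl fun j _ ↦ ?_
      rw [neg_pow X, ← mul_assoc, ← pow_add, Even.neg_one_pow, one_mul, map_one, one_mul]
      rw [sq, add_comm, ← Nat.mul_succ]
      exact Nat.even_mul_succ_self _
  refine mul_right_cancel₀ hA₂ ?_
  linear_combination O * D * h2 - O * h1 + phiPos R * A₂ * hOD

end GeneratingFunction

section Trisection

variable {R : Type*} [CommRing R]

/-- The series whose `n`-th coefficient is the `3 * n`-th coefficient of `F`. -/
noncomputable def trisect (F : R⟦X⟧) : R⟦X⟧ := PowerSeries.mk fun n ↦ coeff (3 * n) F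

lemma trisect_mul_expand (F G : R⟦X⟧) :
    trisect (F * G.expand 3 three_ne_zero) = trisect F * G := by
  ext n
  rw [trisect, coeff_mk, PowerSeries.coeff_mul, PowerSeries.coeff_mul]
  symm
  refine Finset.sum_of_injOn (fun p ↦ (3 * p.1, 3 * p.2)) ?_ ?_ ?_ ?_
  · rintro ⟨a, b⟩ _ ⟨c, d⟩ _ h
    simpa using h
  · rintro ⟨a, b⟩ h
    simp only [Finset.mem_coe, Finset.HasAntidiagonal.mem_antidiagonal] at h ⊢
    omega
  · rintro ⟨a, b⟩ h h'
    rw [Finset.HasAntidiagonal.mem_antidiagonal] at h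
    rw [coeff_expand_of_not_dvd, mul_zero]
    rintro ⟨c, rfl⟩
    refine h' ⟨(n - c, c), ?_, ?_⟩
    · simp only [Finset.mem_coe, Finset.HasAntidiagonal.mem_antidiagonal]
      omega
    · simp only [Prod.mk.injEq, and_true]
      omega
  · rintro ⟨a, b⟩ _
    rw [coeff_expand_mul, trisect, coeff_mk]

lemma neg_one_pow_natAbs_add (x y : ℤ) :
    (-1 : R) ^ (x + y).natAbs = (-1) ^ x.natAbs * (-1) ^ y.natAbs := by
  rw [← pow_add]
  refine neg_one_pow_congr ?_
  rw [Nat.even_add, Int.natAbs_even, Int.natAbs_even, Int.natAbs_even, Int.even_add]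

lemma neg_one_pow_natAbs_mul_of_odd {k : ℤ} (hk : Odd k) (x : ℤ) :
    (-1 : R) ^ (k * x).natAbs = (-1) ^ x.natAbs := by
  refine neg_one_pow_congr ?_
  rw [Int.natAbs_even, Int.natAbs_even, Int.even_mul]
  simp [Int.not_even_iff_odd.mpr hk]

lemma neg_one_pow_natAbs_mul_of_even {k : ℤ} (hk : Even k) (x : ℤ) :
    (-1 : R) ^ (k * x).natAbs = 1 := by
  refine Even.neg_one_pow ?_
  rw [Int.natAbs_even]
  exact hk.mul_right x

lemma trisect_phiPos_mul_phiNeg_sq [CharP R 3] :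
    trisect (phiPos R * phiNeg R 2 * phiNeg R 2) = phiNeg R 1 * phiNeg R 2 * phiNeg R 6 := by
  have hfin (k : ℕ) (hk : k ≠ 0) := finite_preimage_mul_natAbs_sq hk
  have h12 := finite_preimage_add (hfin 1 one_ne_zero) (hfin 2 two_ne_zero)
  have h122 := finite_preimage_add h12 (hfin 2 two_ne_zero)
  rw [phiPos, phiNeg, phiNeg, phiNeg, thetaSeries_mul (hfin 1 one_ne_zero) (hfin 2 two_ne_zero),
    thetaSeries_mul h12 (hfin 2 two_ne_zero),
    thetaSeries_mul (hfin 1 one_ne_zero) (hfin 2 two_ne_zero),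
    thetaSeries_mul h12 (hfin 6 (by norm_num))]
  ext n
  simp only [trisect, thetaSeries, coeff_mk]
  have hS : (fun p : (ℤ × ℤ) × ℤ ↦
      1 * p.1.1.natAbs ^ 2 + 2 * p.1.2.natAbs ^ 2 + 2 * p.2.natAbs ^ 2) ⁻¹' {3 * n} =
      ({p | p.1.1 ^ 2 + 2 * p.1.2 ^ 2 + 2 * p.2 ^ 2 = 3 * (n : ℤ)} : Set ((ℤ × ℤ) × ℤ)) := by
    ext p
    simp [← Int.natCast_inj]
  have hT : (fun p : (ℤ × ℤ) × ℤ ↦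
      1 * p.1.1.natAbs ^ 2 + 2 * p.1.2.natAbs ^ 2 + 6 * p.2.natAbs ^ 2) ⁻¹' {n} =
      ({p | p.1.1 ^ 2 + 2 * p.1.2 ^ 2 + 6 * p.2 ^ 2 = (n : ℤ)} : Set ((ℤ × ℤ) × ℤ)) := by
    ext p
    simp [← Int.natCast_inj]
  have hSfin := h122 (3 * n)
  rw [hS] at hSfin
  rw [hS, hT]
  set S : Set ((ℤ × ℤ) × ℤ) := {p | p.1.1 ^ 2 + 2 * p.1.2 ^ 2 + 2 * p.2 ^ 2 = 3 * (n : ℤ)} with hSdef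
  set T : Set ((ℤ × ℤ) × ℤ) := {p | p.1.1 ^ 2 + 2 * p.1.2 ^ 2 + 6 * p.2 ^ 2 = (n : ℤ)} with hTdef
  let A : Set ((ℤ × ℤ) × ℤ) := {p | p ∈ S ∧ p.2 % 3 = 0 ∧ (p.1.1 - p.1.2) % 3 = 0}
  let B₁ : Set ((ℤ × ℤ) × ℤ) := {p | p ∈ S ∧ p.2 % 3 = 0 ∧ p.1.2 % 3 ≠ 0 ∧ (p.1.1 + p.1.2) % 3 = 0}
  let B₂ : Set ((ℤ × ℤ) × ℤ) := {p | p ∈ S ∧ p.1.2 % 3 = 0 ∧ p.2 % 3 ≠ 0 ∧ (p.1.1 - p.2) % 3 = 0}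
  let B₃ : Set ((ℤ × ℤ) × ℤ) := {p | p ∈ S ∧ p.1.2 % 3 = 0 ∧ p.2 % 3 ≠ 0 ∧ (p.1.1 + p.2) % 3 = 0}
  have hcover : S = A ∪ (B₁ ∪ (B₂ ∪ B₃)) := by
    refine Set.Subset.antisymm ?_ ?_
    · rintro ⟨⟨x, y⟩, z⟩ hp
      have h : x ^ 2 + 2 * y ^ 2 + 2 * z ^ 2 = 3 * n := hp
      have h3 : (x ^ 2 + 2 * y ^ 2 + 2 * z ^ 2) % 3 = 0 := by omega
      simp only [Set.mem_union, Set.mem_ofPred_eq, A, B₁, B₂, B₃, hp, true_and]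
      have hx : x % 3 = 0 ∨ x % 3 = 1 ∨ x % 3 = 2 := by omega
      have hy : y % 3 = 0 ∨ y % 3 = 1 ∨ y % 3 = 2 := by omega
      have hz : z % 3 = 0 ∨ z % 3 = 1 ∨ z % 3 = 2 := by omega
      rcases hx with hx | hx | hx <;> rcases hy with hy | hy | hy <;>
        rcases hz with hz | hz | hz <;>
        first
        | omega
        | simp [pow_two, Int.add_emod, Int.mul_emod, hx, hy, hz] at h3
    · rintro p (h | h | h | h) <;> exact h.1
  have hA : A.Finite := hSfin.subset fun p h ↦ h.1
  have hB₁ : B₁.Finite := hSfin.subset fun p h ↦ h.1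
  have hB₂ : B₂.Finite := hSfin.subset fun p h ↦ h.1
  have hB₃ : B₃.Finite := hSfin.subset fun p h ↦ h.1
  have hdisj : Disjoint A (B₁ ∪ (B₂ ∪ B₃)) ∧ Disjoint B₁ (B₂ ∪ B₃) ∧ Disjoint B₂ B₃ := by
    refine ⟨Set.disjoint_left.mpr ?_, Set.disjoint_left.mpr ?_, Set.disjoint_left.mpr ?_⟩ <;>
    · intro p h h'
      simp only [Set.mem_union, Set.mem_ofPred_eq, A, B₁, B₂, B₃] at h h'
      omega
  rw [hcover, finsum_mem_union hdisj.1 hA (hB₁.union (hB₂.union hB₃)),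
    finsum_mem_union hdisj.2.1 hB₁ (hB₂.union hB₃), finsum_mem_union hdisj.2.2 hB₂ hB₃]
  have h₂ : ∑ᶠ p ∈ B₁, 1 * (-1 : R) ^ p.1.2.natAbs * (-1) ^ p.2.natAbs =
      ∑ᶠ p ∈ B₂, 1 * (-1 : R) ^ p.1.2.natAbs * (-1) ^ p.2.natAbs := by
    refine finsum_mem_eq_of_bijOn (fun p ↦ ((p.1.1, p.2), -p.1.2))
      (Set.InvOn.bijOn (f' := fun p ↦ ((p.1.1, -p.2), p.1.2)) ⟨?_, ?_⟩ ?_ ?_) ?_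
    · intro p _
      simp
    · intro p _
      simp
    · rintro p ⟨h, h'⟩
      refine ⟨?_, ?_⟩
      · simp only [hSdef, Set.mem_ofPred_eq] at h ⊢
        linarith
      · simp only
        omega
    · rintro p ⟨h, h'⟩
      refine ⟨?_, ?_⟩
      · simp only [hSdef, Set.mem_ofPred_eq] at h ⊢
        linarith
      · simp only
        omega
    · intro p _
      simp only [Int.natAbs_neg]
      ring
  have h₃ : ∑ᶠ p ∈ B₁, 1 * (-1 : R) ^ p.1.2.natAbs * (-1) ^ p.2.natAbs =
      ∑ᶠ p ∈ B₃, 1 * (-1 : R) ^ p.1.2.natAbs * (-1) ^ p.2.natAbs := by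
    refine finsum_mem_eq_of_bijOn (fun p ↦ ((p.1.1, p.2), p.1.2))
      (Set.InvOn.bijOn (f' := fun p ↦ ((p.1.1, p.2), p.1.2)) ⟨?_, ?_⟩ ?_ ?_) ?_
    · intro p _
      simp
    · intro p _
      simp
    · rintro p ⟨h, h'⟩
      refine ⟨?_, ?_⟩
      · simp only [hSdef, Set.mem_ofPred_eq] at h ⊢
        linarith
      · simp only
        omega
    · rintro p ⟨h, h'⟩
      refine ⟨?_, ?_⟩
      · simp only [hSdef, Set.mem_ofPred_eq] at h ⊢
        linarith
      · simp only
        omega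
    · intro p _
      ring
  have h₀ : ∑ᶠ p ∈ T, (-1 : R) ^ p.1.1.natAbs * (-1) ^ p.1.2.natAbs * (-1) ^ p.2.natAbs =
      ∑ᶠ p ∈ A, 1 * (-1 : R) ^ p.1.2.natAbs * (-1) ^ p.2.natAbs := by
    refine finsum_mem_eq_of_bijOn (fun p ↦ ((p.1.1 - 2 * p.1.2, p.1.1 + p.1.2), 3 * p.2))
      (Set.InvOn.bijOn
        (f' := fun p ↦ (((p.1.1 + 2 * p.1.2) / 3, (p.1.2 - p.1.1) / 3), p.2 / 3)) ⟨?_, ?_⟩ ?_ ?_) ?_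
    · rintro ⟨⟨x, y⟩, z⟩ _
      simp only [Prod.mk.injEq]
      omega
    · rintro ⟨⟨x, y⟩, z⟩ ⟨_, h⟩
      simp only [Prod.mk.injEq] at h ⊢
      omega
    · rintro ⟨⟨x, y⟩, z⟩ h
      refine ⟨?_, ?_⟩
      · simp only [hSdef, hTdef, Set.mem_ofPred_eq] at h ⊢
        linear_combination 3 * h
      · simp only
        omega
    · rintro ⟨⟨x, y⟩, z⟩ ⟨h, h'⟩
      simp only [hSdef, hTdef, Set.mem_ofPred_eq] at h h' ⊢
      have hu : 3 * ((x + 2 * y) / 3) = x + 2 * y := by omega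
      have hv : 3 * ((y - x) / 3) = y - x := by omega
      have hz : 3 * (z / 3) = z := by omega
      refine mul_left_cancel₀ (show (9 : ℤ) ≠ 0 by norm_num) ?_
      have : 9 * (((x + 2 * y) / 3) ^ 2 + 2 * ((y - x) / 3) ^ 2 + 6 * (z / 3) ^ 2) =
          (3 * ((x + 2 * y) / 3)) ^ 2 + 2 * (3 * ((y - x) / 3)) ^ 2 + 6 * (3 * (z / 3)) ^ 2 := by
        ring
      rw [this, hu, hv, hz]
      linear_combination 3 * h
    · rintro ⟨⟨x, y⟩, z⟩ _
      rw [neg_one_pow_natAbs_add, neg_one_pow_natAbs_mul_of_odd (by decide), one_mul]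
  have h3 : (3 : R) = 0 := by exact_mod_cast CharP.cast_eq_zero R 3
  rw [h₀, ← h₂, ← h₃]
  linear_combination (∑ᶠ p ∈ B₁, 1 * (-1 : R) ^ p.1.2.natAbs * (-1) ^ p.2.natAbs) * h3

lemma phiNeg_ne_zero [Nontrivial R] {k : ℕ} (hk : k ≠ 0) : phiNeg R k ≠ 0 := by
  intro h
  have h0 : coeff 0 (phiNeg R k) = 1 := by
    have : (fun j : ℤ ↦ k * j.natAbs ^ 2) ⁻¹' {0} = {0} := by
      ext j
      simp [hk]
    rw [phiNeg, thetaSeries, coeff_mk, this, finsum_mem_singleton]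
    simp
  simp [h] at h0

end Trisection

lemma expand_three_eq_pow (F : (ZMod 3)⟦X⟧) : F.expand 3 three_ne_zero = F ^ 3 := by
  rw [← MvPowerSeries.map_frobenius_expand 3 three_ne_zero, ZMod.frobenius_zmod]
  exact (PowerSeries.ext fun n ↦ rfl)

/-- Modulo 3, the generating function of `pbarOdd (3 * n)` is `φ(-X) * φ(-X ^ 6)`. -/
lemma trisect_mk_pbarOdd :
    trisect (PowerSeries.mk fun n ↦ (pbarOdd n : ZMod 3)) =
      phiNeg (ZMod 3) 1 * phiNeg (ZMod 3) 6 := by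
  refine mul_right_cancel₀ (phiNeg_ne_zero (R := ZMod 3) two_ne_zero) ?_
  rw [← trisect_mul_expand, expand_three_eq_pow, pow_three, ← mul_assoc,
    mk_pbarOdd_mul_phiNeg_two, ← mul_assoc, trisect_phiPos_mul_phiNeg_sq]
  ring

section QuadraticForm

lemma exists_dvd_sq_add_six {ℓ : ℕ} (hl : ℓ.Prime)
    (hmod : ℓ % 24 = 1 ∨ ℓ % 24 = 5 ∨ ℓ % 24 = 7 ∨ ℓ % 24 = 11) :
    ∃ r : ℤ, (ℓ : ℤ) ∣ r ^ 2 + 6 := by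
  have : Fact ℓ.Prime := ⟨hl⟩
  have hodd : Odd ℓ := Nat.odd_iff.mpr (by omega)
  have hJ : jacobiSym (-6) ℓ = 1 := by
    rw [jacobiSym.mod_right (-6) hodd]
    rcases hmod with h | h | h | h <;> simp [h] <;> norm_num
  obtain ⟨s, hs⟩ := ZMod.isSquare_of_jacobiSym_eq_one hJ
  obtain ⟨r, rfl⟩ := ZMod.intCast_surjective s
  refine ⟨r, (ZMod.intCast_zmod_eq_zero_iff_dvd _ ℓ).mp ?_⟩
  push_cast at hs ⊢
  linear_combination -hs

lemma exists_dvd_and_sq_add_six_mul_sq_le {ℓ : ℕ} (hl : ℓ.Prime) {r : ℤ}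
    (hr : (ℓ : ℤ) ∣ r ^ 2 + 6) :
    ∃ x y : ℤ, 0 < y ∧ (ℓ : ℤ) ∣ x ^ 2 + 6 * y ^ 2 ∧ x ^ 2 + 6 * y ^ 2 < 7 * ℓ := by
  have hpos : (0 : ℝ) < ℓ := by exact_mod_cast hl.pos
  have hsq : 0 < Nat.sqrt ℓ := Nat.sqrt_pos.mpr hl.pos
  obtain ⟨j, k, hk, hkn, h⟩ := Real.exists_int_int_abs_mul_sub_le (r / ℓ : ℝ) hsq
  refine ⟨k * r - j * ℓ, k, hk, ?_, ?_⟩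
  · obtain ⟨t, ht⟩ := hr
    exact ⟨k ^ 2 * t - 2 * k * r * j + j ^ 2 * ℓ, by linear_combination k ^ 2 * ht⟩
  · have hy : k ^ 2 ≤ ℓ := by
      have : (Nat.sqrt ℓ : ℤ) ^ 2 ≤ ℓ := by exact_mod_cast Nat.sqrt_le' ℓ
      nlinarith
    have hx : (k * r - j * ℓ) ^ 2 < (ℓ : ℤ) := by
      have h1 : (k * r - j * ℓ : ℝ) = (k * (r / ℓ) - j) * ℓ := by field_simp
      have hn : (ℓ : ℝ) < ((Nat.sqrt ℓ : ℝ) + 1) ^ 2 := by exact_mod_cast Nat.lt_succ_sqrt' ℓ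
      have h2 : |(k * r - j * ℓ : ℝ)| * ((Nat.sqrt ℓ : ℝ) + 1) ≤ ℓ := by
        rw [h1, abs_mul, abs_of_pos hpos]
        rw [le_div_iff₀ (by positivity)] at h
        nlinarith
      have h3 : (k * r - j * ℓ : ℝ) ^ 2 < ℓ := by
        rw [← sq_abs]
        by_contra! hc
        have h4 : (|(k * r - j * ℓ : ℝ)| * ((Nat.sqrt ℓ : ℝ) + 1)) ^ 2 ≤ (ℓ : ℝ) ^ 2 :=
          pow_le_pow_left₀ (by positivity) h2 2
        rw [mul_pow] at h4
        nlinarith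
      exact_mod_cast h3
    linarith

lemma exists_factors_of_sq_add_six_mul_sq {ℓ x y : ℤ} (hdvd : ℓ ∣ x ^ 2 + 6 * y ^ 2)
    (hpos : 0 < ℓ) (hy : 0 < y) (hlt : x ^ 2 + 6 * y ^ 2 < 7 * ℓ) :
    ∃ p q c d : ℤ, p * q = 6 ∧ p * c ^ 2 + q * d ^ 2 = ℓ := by
  obtain ⟨m, hm⟩ := hdvd
  have hm0 : 0 < m := by
    by_contra! h
    nlinarith [sq_nonneg x, mul_pos hy hy]
  have hm7 : m < 7 := by
    by_contra! h
    nlinarith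
  have two_dvd (h : (2 : ℤ) ∣ x ^ 2) : ∃ t, x = 2 * t := Int.prime_two.dvd_of_dvd_pow h
  have three_dvd (h : (3 : ℤ) ∣ x ^ 2) : ∃ t, x = 3 * t := Int.prime_three.dvd_of_dvd_pow h
  interval_cases m
  · exact ⟨1, 6, x, y, by norm_num, by linarith⟩
  · obtain ⟨t, rfl⟩ := two_dvd ⟨ℓ - 3 * y ^ 2, by linarith⟩
    exact ⟨2, 3, t, y, by norm_num, by linarith⟩
  · obtain ⟨t, rfl⟩ := three_dvd ⟨ℓ - 2 * y ^ 2, by linarith⟩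
    exact ⟨3, 2, t, y, by norm_num, by linarith⟩
  · obtain ⟨t, rfl⟩ := two_dvd ⟨2 * ℓ - 3 * y ^ 2, by linarith⟩
    have : (2 : ℤ) ∣ y ^ 2 := by
      have h : 2 * t ^ 2 + 3 * y ^ 2 = 2 * ℓ := by linarith
      omega
    obtain ⟨s, rfl⟩ := Int.prime_two.dvd_of_dvd_pow this
    exact ⟨1, 6, t, s, by norm_num, by linarith⟩
  · have h5 : (5 : ℤ) ∣ (x + 2 * y) * (x - 2 * y) := ⟨ℓ - 2 * y ^ 2, by linarith⟩
    have hp : Prime (5 : ℤ) := by norm_num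
    rcases hp.dvd_or_dvd h5 with ⟨t, ht⟩ | ⟨t, ht⟩
    · obtain rfl : x = 5 * t - 2 * y := by linarith
      exact ⟨2, 3, t - y, t, by norm_num, by linarith⟩
    · obtain rfl : x = 5 * t + 2 * y := by linarith
      exact ⟨2, 3, t + y, t, by norm_num, by linarith⟩
  · obtain ⟨t, rfl⟩ := two_dvd ⟨3 * ℓ - 3 * y ^ 2, by linarith⟩
    have : (3 : ℤ) ∣ t ^ 2 := by
      have h : 2 * t ^ 2 + 3 * y ^ 2 = 3 * ℓ := by linarith
      omega
    obtain ⟨s, rfl⟩ := Int.prime_three.dvd_of_dvd_pow this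
    exact ⟨6, 1, s, y, by norm_num, by linarith⟩

lemma not_dvd_six {ℓ : ℕ} (hl : ℓ.Prime)
    (hmod : ℓ % 24 = 1 ∨ ℓ % 24 = 5 ∨ ℓ % 24 = 7 ∨ ℓ % 24 = 11) : ¬ (ℓ : ℤ) ∣ 6 := by
  intro h
  have h' : ℓ ∣ 6 := by exact_mod_cast h
  have hle := Nat.le_of_dvd (by norm_num) h'
  have := hl.two_le
  interval_cases ℓ <;> omega

lemma exists_sq_add_six_mul_sq_eq_sq {ℓ : ℕ} (hl : ℓ.Prime)
    (hmod : ℓ % 24 = 1 ∨ ℓ % 24 = 5 ∨ ℓ % 24 = 7 ∨ ℓ % 24 = 11) :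
    ∃ a b : ℤ, a ^ 2 + 6 * b ^ 2 = ℓ ^ 2 ∧ Even b ∧ ¬ (ℓ : ℤ) ∣ b := by
  obtain ⟨r, hr⟩ := exists_dvd_sq_add_six hl hmod
  obtain ⟨x, y, hy, hdvd, hlt⟩ := exists_dvd_and_sq_add_six_mul_sq_le hl hr
  obtain ⟨p, q, c, d, hpq, h⟩ :=
    exists_factors_of_sq_add_six_mul_sq hdvd (by exact_mod_cast hl.pos) hy hlt
  have hp : Prime (ℓ : ℤ) := Nat.prime_iff_prime_int.mp hl
  have hcd (p q c d : ℤ) (hpq : p * q = 6) (h : p * c ^ 2 + q * d ^ 2 = ℓ) : ¬ (ℓ : ℤ) ∣ c := by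
    rintro ⟨s, rfl⟩
    have hd : (ℓ : ℤ) ∣ q * d ^ 2 := ⟨1 - p * ℓ * s ^ 2, by linear_combination h⟩
    rcases hp.dvd_or_dvd hd with hq | hd
    · exact not_dvd_six hl hmod (hpq ▸ hq.mul_left p)
    · obtain ⟨t, rfl⟩ := hp.dvd_of_dvd_pow hd
      refine hp.not_isUnit (IsUnit.of_mul_eq_one (p * s ^ 2 + q * t ^ 2)
        (mul_left_cancel₀ hp.ne_zero ?_))
      linear_combination h
  refine ⟨p * c ^ 2 - q * d ^ 2, 2 * (c * d), ?_, even_two_mul _, fun hb ↦ ?_⟩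
  · rw [← h]
    linear_combination -4 * c ^ 2 * d ^ 2 * hpq
  · have h6 := not_dvd_six hl hmod
    rcases hp.dvd_or_dvd hb with hb | hb
    · exact h6 (hb.trans ⟨3, by norm_num⟩)
    · rcases hp.dvd_or_dvd hb with hb | hb
      · exact hcd p q c d hpq h hb
      · exact hcd q p d c (by linarith) (by linarith) hb

end QuadraticForm

section Hecke

/-- The integer solutions of `x ^ 2 + 6 * y ^ 2 = n`. -/
def solutions (n : ℤ) : Set (ℤ × ℤ) := {v | v.1 ^ 2 + 6 * v.2 ^ 2 = n}

/-- Multiplication by `a + b * √-6` on `ℤ[√-6]`, in coordinates. -/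
def mulSqrtd (a b : ℤ) (v : ℤ × ℤ) : ℤ × ℤ := (a * v.1 - 6 * b * v.2, a * v.2 + b * v.1)

lemma mulSqrtd_mem_solutions {p a b n : ℤ} (hab : a ^ 2 + 6 * b ^ 2 = p ^ 2) {v : ℤ × ℤ}
    (hv : v ∈ solutions n) : mulSqrtd a b v ∈ solutions (p ^ 2 * n) := by
  simp only [solutions, mulSqrtd, Set.mem_ofPred_eq] at hv ⊢
  rw [← hab, ← hv]
  ring

lemma mulSqrtd_neg_mulSqrtd {p a b : ℤ} (hab : a ^ 2 + 6 * b ^ 2 = p ^ 2) (v : ℤ × ℤ) :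
    mulSqrtd a (-b) (mulSqrtd a b v) = (p ^ 2 * v.1, p ^ 2 * v.2) := by
  simp only [mulSqrtd, Prod.mk.injEq]
  constructor <;> rw [← hab] <;> ring

lemma mulSqrtd_injective {p a b : ℤ} (hp : p ≠ 0) (hab : a ^ 2 + 6 * b ^ 2 = p ^ 2) :
    Function.Injective (mulSqrtd a b) := by
  intro v w h
  have h' := congrArg (mulSqrtd a (-b)) h
  rw [mulSqrtd_neg_mulSqrtd hab, mulSqrtd_neg_mulSqrtd hab] at h'
  simpa [hp, Prod.ext_iff] using h'

lemma not_dvd_snd_mulSqrtd {p : ℤ} (hp : Prime p) {a b n : ℤ}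
    (hab : a ^ 2 + 6 * b ^ 2 = p ^ 2) (hb : ¬ p ∣ b) (hn : ¬ p ∣ n) {v : ℤ × ℤ}
    (hv : v ∈ solutions n) : ¬ p ∣ (mulSqrtd a b v).2 := by
  rintro ⟨t, ht⟩
  simp only [solutions, mulSqrtd, Set.mem_ofPred_eq] at hv ht
  have hdvd : p ∣ b ^ 2 * n :=
    ⟨t * (b * v.1 - a * v.2) + p * v.2 ^ 2, by
      linear_combination b ^ 2 * (-hv) + v.2 ^ 2 * hab + (b * v.1 - a * v.2) * ht⟩
  rcases hp.dvd_or_dvd hdvd with h | h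
  · exact hb (hp.dvd_of_dvd_pow h)
  · exact hn h

lemma mem_image_mulSqrtd {p : ℤ} (hp : Prime p) {a b n : ℤ} (hab : a ^ 2 + 6 * b ^ 2 = p ^ 2)
    {v : ℤ × ℤ} (hv : v ∈ solutions (p ^ 2 * n)) (h : ¬ p ∣ (mulSqrtd a b v).2) :
    v ∈ mulSqrtd a b '' solutions n := by
  have hab' : a ^ 2 + 6 * (-b) ^ 2 = p ^ 2 := by rw [neg_sq, hab]
  have hmem := mulSqrtd_mem_solutions hab' hv
  have hv' : v.1 ^ 2 + 6 * v.2 ^ 2 = p ^ 2 * n := hv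
  have hY : p ^ 2 ∣ (mulSqrtd a (-b) v).2 := by
    refine (hp.pow_dvd_of_dvd_mul_left 2 h ⟨v.2 ^ 2 - b ^ 2 * n, ?_⟩)
    simp only [mulSqrtd]
    linear_combination v.2 ^ 2 * hab - b ^ 2 * hv'
  obtain ⟨y, hy⟩ := hY
  have hX : p ^ 2 ∣ (mulSqrtd a (-b) v).1 := by
    refine (Int.pow_dvd_pow_iff two_ne_zero).mp ⟨n - 6 * y ^ 2, ?_⟩
    have hmem' : (mulSqrtd a (-b) v).1 ^ 2 + 6 * (mulSqrtd a (-b) v).2 ^ 2 =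
      p ^ 2 * (p ^ 2 * n) := hmem
    rw [hy] at hmem'
    linear_combination hmem'
  obtain ⟨x, hx⟩ := hX
  have hp2 : p ^ 2 ≠ 0 := pow_ne_zero 2 hp.ne_zero
  refine ⟨(x, y), ?_, ?_⟩
  · have hmem' : (mulSqrtd a (-b) v).1 ^ 2 + 6 * (mulSqrtd a (-b) v).2 ^ 2 =
      p ^ 2 * (p ^ 2 * n) := hmem
    rw [hx, hy] at hmem'
    refine mul_left_cancel₀ (mul_ne_zero hp2 hp2) ?_
    linear_combination hmem'
  · have hinv := mulSqrtd_neg_mulSqrtd hab' v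
    rw [neg_neg, show mulSqrtd a (-b) v = (p ^ 2 * x, p ^ 2 * y) from Prod.ext hx hy] at hinv
    simp only [mulSqrtd, Prod.mk.injEq] at hinv
    refine Prod.ext (mul_left_cancel₀ hp2 ?_) (mul_left_cancel₀ hp2 ?_)
    · simp only [mulSqrtd]
      linear_combination hinv.1
    · simp only [mulSqrtd]
      linear_combination hinv.2

lemma mem_image_mulSqrtd_zero {p : ℤ} (hp : Prime p) (h6 : ¬ p ∣ 6) {a b n : ℤ} (hb : ¬ p ∣ b)
    {v : ℤ × ℤ} (hv : v ∈ solutions (p ^ 2 * n)) (h₁ : p ∣ (mulSqrtd a b v).2)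
    (h₂ : p ∣ (mulSqrtd a (-b) v).2) : v ∈ mulSqrtd p 0 '' solutions n := by
  obtain ⟨x, y⟩ := v
  have hv' : x ^ 2 + 6 * y ^ 2 = p ^ 2 * n := hv
  have hx : p ∣ x := by
    have h : p ∣ 6 * (b * x) := by
      rw [show 6 * (b * x) = 3 * (a * y + b * x - (a * y + -b * x)) by ring]
      exact (dvd_sub h₁ h₂).mul_left 3
    exact (hp.dvd_or_dvd ((hp.dvd_or_dvd h).resolve_left h6)).resolve_left hb
  obtain ⟨x, rfl⟩ := hx
  have hy : p ∣ 6 * y ^ 2 := ⟨p * (n - x ^ 2), by linear_combination hv'⟩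
  obtain ⟨y, rfl⟩ := hp.dvd_of_dvd_pow ((hp.dvd_or_dvd hy).resolve_left h6)
  refine ⟨(x, y), mul_left_cancel₀ (pow_ne_zero 2 hp.ne_zero) ?_, ?_⟩
  · linear_combination hv'
  · simp [mulSqrtd]

lemma solutions_prime_sq_mul {p : ℤ} (hp : Prime p) (h6 : ¬ p ∣ 6) {a b : ℤ}
    (hab : a ^ 2 + 6 * b ^ 2 = p ^ 2) (hb : ¬ p ∣ b) (n : ℤ) :
    solutions (p ^ 2 * n) = mulSqrtd p 0 '' solutions n ∪
      (mulSqrtd a b '' solutions n ∪ mulSqrtd a (-b) '' solutions n) := by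
  have hab' : a ^ 2 + 6 * (-b) ^ 2 = p ^ 2 := by rw [neg_sq, hab]
  refine Set.Subset.antisymm (fun v hv ↦ ?_) ?_
  · by_cases h₁ : p ∣ (mulSqrtd a b v).2
    · by_cases h₂ : p ∣ (mulSqrtd a (-b) v).2
      · exact Or.inl (mem_image_mulSqrtd_zero hp h6 hb hv h₁ h₂)
      · exact Or.inr (Or.inr (mem_image_mulSqrtd hp hab' hv h₂))
    · exact Or.inr (Or.inl (mem_image_mulSqrtd hp hab hv h₁))
  · rintro v (⟨w, hw, rfl⟩ | ⟨w, hw, rfl⟩ | ⟨w, hw, rfl⟩)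
    exacts [mulSqrtd_mem_solutions (by ring) hw, mulSqrtd_mem_solutions hab hw,
      mulSqrtd_mem_solutions hab' hw]

lemma disjoint_image_mulSqrtd_zero {p : ℤ} (hp : Prime p) {a b n : ℤ}
    (hab : a ^ 2 + 6 * b ^ 2 = p ^ 2) (hb : ¬ p ∣ b) (hn : ¬ p ∣ n) :
    Disjoint (mulSqrtd p 0 '' solutions n) (mulSqrtd a b '' solutions n) := by
  refine Set.disjoint_left.mpr ?_
  rintro _ ⟨v, _, rfl⟩ ⟨w, hw, h⟩
  refine not_dvd_snd_mulSqrtd hp hab hb hn hw ?_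
  rw [h]
  simp [mulSqrtd]

lemma disjoint_image_mulSqrtd_neg {p : ℤ} (hp : Prime p) (h6 : ¬ p ∣ 6) {a b n : ℤ}
    (hab : a ^ 2 + 6 * b ^ 2 = p ^ 2) (hb : ¬ p ∣ b) (hn : ¬ p ∣ n) :
    Disjoint (mulSqrtd a b '' solutions n) (mulSqrtd a (-b) '' solutions n) := by
  have hab' : a ^ 2 + 6 * (-b) ^ 2 = p ^ 2 := by rw [neg_sq, hab]
  refine Set.disjoint_left.mpr ?_
  rintro _ ⟨v, hv, rfl⟩ ⟨w, hw, h⟩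
  refine Set.disjoint_left.mp (disjoint_image_mulSqrtd_zero hp hab hb hn)
    (mem_image_mulSqrtd_zero (a := a) hp h6 hb (mulSqrtd_mem_solutions hab hv) ?_ ?_)
    (Set.mem_image_of_mem _ hv)
  · have := mulSqrtd_neg_mulSqrtd hab' w
    rw [neg_neg, h] at this
    rw [this]
    exact (dvd_pow_self p two_ne_zero).mul_right _
  · rw [mulSqrtd_neg_mulSqrtd hab]
    exact (dvd_pow_self p two_ne_zero).mul_right _

/-- The parity sign of a solution. -/
def paritySign (R : Type*) [CommRing R] (v : ℤ × ℤ) : R := (-1) ^ v.1.natAbs * (-1) ^ v.2.natAbs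

lemma paritySign_mulSqrtd {R : Type*} [CommRing R] {a b : ℤ} (ha : Odd a) (hb : Even b) (v : ℤ × ℤ) :
    paritySign R (mulSqrtd a b v) = paritySign R v := by
  simp only [paritySign, mulSqrtd]
  rw [sub_eq_add_neg, neg_mul_eq_neg_mul, neg_one_pow_natAbs_add, neg_one_pow_natAbs_add,
    neg_one_pow_natAbs_mul_of_odd ha, neg_one_pow_natAbs_mul_of_odd ha,
    neg_one_pow_natAbs_mul_of_even (hb.mul_left 6).neg, neg_one_pow_natAbs_mul_of_even hb]
  ring

lemma finsum_paritySign_solutions_prime_sq_mul {R : Type*} [CommRing R] {p : ℤ} (hp : Prime p)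
    (h6 : ¬ p ∣ 6) {a b n : ℤ} (hab : a ^ 2 + 6 * b ^ 2 = p ^ 2) (hb : ¬ p ∣ b)
    (hb2 : Even b) (hp2 : Odd p) (hn : ¬ p ∣ n) (hfin : (solutions n).Finite) :
    ∑ᶠ v ∈ solutions (p ^ 2 * n), paritySign R v = 3 * ∑ᶠ v ∈ solutions n, paritySign R v := by
  have hab' : a ^ 2 + 6 * (-b) ^ 2 = p ^ 2 := by rw [neg_sq, hab]
  have hb' : ¬ p ∣ -b := by rwa [dvd_neg]
  have ha : Odd a := by
    have h : Odd (a ^ 2) := by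
      rw [show a ^ 2 = p ^ 2 - 6 * b * b by linear_combination hab]
      exact (hp2.pow).sub_even (hb2.mul_left _)
    exact (Int.odd_pow.mp h).resolve_right two_ne_zero
  have hsum {c d : ℤ} (hcd : c ^ 2 + 6 * d ^ 2 = p ^ 2) (hc : Odd c) (hd : Even d) :
      ∑ᶠ v ∈ mulSqrtd c d '' solutions n, paritySign R v = ∑ᶠ v ∈ solutions n, paritySign R v := by
    rw [finsum_mem_image (mulSqrtd_injective hp.ne_zero hcd).injOn]
    simp only [paritySign_mulSqrtd hc hd]
  rw [solutions_prime_sq_mul hp h6 hab hb,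
    finsum_mem_union _ (hfin.image _) ((hfin.image _).union (hfin.image _)),
    finsum_mem_union (disjoint_image_mulSqrtd_neg hp h6 hab hb hn) (hfin.image _) (hfin.image _),
    hsum (by ring) hp2 Even.zero, hsum hab ha hb2, hsum hab' ha hb2.neg]
  · ring
  · exact Set.disjoint_union_right.mpr ⟨disjoint_image_mulSqrtd_zero hp hab hb hn,
      disjoint_image_mulSqrtd_zero hp hab' hb' hn⟩

lemma finite_solutions (n : ℕ) : (solutions n).Finite := by
  refine (finite_preimage_add (finite_preimage_mul_natAbs_sq one_ne_zero)
    (finite_preimage_mul_natAbs_sq (k := 6) (by norm_num)) n).subset fun v hv ↦ ?_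
  have h : v.1 ^ 2 + 6 * v.2 ^ 2 = n := hv
  simp [← Int.natCast_inj, h]

lemma coeff_phiNeg_one_mul_phiNeg_six {R : Type*} [CommRing R] (n : ℕ) :
    coeff n (phiNeg R 1 * phiNeg R 6) = ∑ᶠ v ∈ solutions n, paritySign R v := by
  rw [phiNeg, phiNeg, thetaSeries_mul (finite_preimage_mul_natAbs_sq one_ne_zero)
    (finite_preimage_mul_natAbs_sq (by norm_num)), thetaSeries, coeff_mk]
  have h : (fun v : ℤ × ℤ ↦ 1 * v.1.natAbs ^ 2 + 6 * v.2.natAbs ^ 2) ⁻¹' {n} = solutions n := by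
    ext v
    simp [solutions, ← Int.natCast_inj]
  rw [h]
  rfl

end Hecke

theorem pbarOdd_prime_sq (ℓ : ℕ) (hl : ℓ.Prime)
    (hmod : ℓ % 24 = 1 ∨ ℓ % 24 = 5 ∨ ℓ % 24 = 7 ∨ ℓ % 24 = 11)
    (n : ℕ) (hn : 0 < n) (hndvd : ¬ ℓ ∣ n) :
    pbarOdd (3 * ℓ ^ 2 * n) ≡ 0 [MOD 3] := by
  obtain ⟨a, b, hab, hb, hlb⟩ := exists_sq_add_six_mul_sq_eq_sq hl hmod
  have hodd : Odd (ℓ : ℤ) := by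
    rw [Int.odd_iff]
    omega
  rw [← ZMod.natCast_eq_natCast_iff, Nat.cast_zero]
  calc (pbarOdd (3 * ℓ ^ 2 * n) : ZMod 3)
      = coeff (ℓ ^ 2 * n) (phiNeg (ZMod 3) 1 * phiNeg (ZMod 3) 6) := by
        rw [← trisect_mk_pbarOdd, trisect, coeff_mk, coeff_mk, mul_assoc]
    _ = 3 * ∑ᶠ v ∈ solutions n, paritySign (ZMod 3) v := by
        rw [coeff_phiNeg_one_mul_phiNeg_six]
        push_cast
        exact finsum_paritySign_solutions_prime_sq_mul (Nat.prime_iff_prime_int.mp hl)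
          (not_dvd_six hl hmod) hab hlb hb
          hodd (by exact_mod_cast hndvd) (finite_solutions n)
    _ = 0 := by rw [show (3 : ZMod 3) = 0 from rfl, zero_mul]
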